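/- Let 2 ≤ k ≤ n−2 be integers with k even, and set p̄₁ = 1 − 1/(n−k+1). Then there exists a real number p̄₂ < p̄₁ such that for all p ∈ [p̄₂, p̄₁], M(n,k,p) = B(n, k, 1−p) + (C(n, k+1)/C(n−k+1, 2)) · (1−p)^{k−1} · B(n−k+1, 1, 1−p). -/

import Mathlib

open scoped BigOperators

noncomputable section

/-- The probability, under the mass function `f` on `{0,1}^n`, of the event that
all coordinates in `S` equal `1` (i.e. `true`). -/
def prAll {n : ℕ} (f : (Fin n → Bool) → ℝ) (S : Finset (Fin n)) : ℝ :=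
  ∑ x ∈ Finset.univ.filter (fun x : Fin n → Bool => ∀ i ∈ S, x i = true), f x

/-- `f` is the mass function of a probability measure on `{0,1}^n` making the
coordinate random variables `k`-wise independent Bernoulli(`p`) bits:
`P(X_{i₁} = ⋯ = X_{i_s} = 1) = p ^ s` for all `1 ≤ s ≤ k`. -/
def memA (n k : ℕ) (p : ℝ) (f : (Fin n → Bool) → ℝ) : Prop :=
  (∀ x, 0 ≤ f x) ∧ (∑ x, f x) = 1 ∧
    ∀ S : Finset (Fin n), 1 ≤ S.card → S.card ≤ k → prAll f S = p ^ S.card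

/-- `M n k p`: the maximum of `P(X₁ = ⋯ = Xₙ = 1)` over `A(n,k,p)`. -/
def M (n k : ℕ) (p : ℝ) : ℝ :=
  sSup {y : ℝ | ∃ f, memA n k p f ∧ prAll f Finset.univ = y}

/-- Bonferroni polynomial `B(m,l,x) = Σ_{i=0}^{l} (−1)^i C(m,i) x^i`;
by convention it is `0` for negative `l`. -/
def bonf (m : ℕ) (l : ℤ) (x : ℝ) : ℝ :=
  if l < 0 then 0
  else ∑ i ∈ Finset.range (l.toNat + 1), (-1 : ℝ) ^ i * (m.choose i) * x ^ i

/-- Alternating Vandermonde-type identity. -/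
lemma sum_alternating_choose_mul_choose (m : ℕ) : ∀ r t : ℕ, m ≤ r + t →
    ∑ j ∈ Finset.range (m + 1), (-1 : ℝ) ^ j * (m.choose j) * ((r + t - j).choose r) =
      ((r + t - m).choose t) := by
  induction m with
  | zero =>
    intro r t _
    simpa using (Nat.choose_symm_add (a := r) (b := t))
  | succ m ih =>
    intro r t h
    have hrec : ∑ j ∈ Finset.range (m + 1 + 1),
          (-1 : ℝ) ^ j * ((m + 1).choose j) * ((r + t - j).choose r) =
        ∑ j ∈ Finset.range (m + 1), (-1 : ℝ) ^ j * (m.choose j) * ((r + t - j).choose r) -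
        ∑ j ∈ Finset.range (m + 1), (-1 : ℝ) ^ j * (m.choose j) * ((r + t - 1 - j).choose r) := by
      rw [Finset.sum_range_succ' _ (m + 1)]
      rw [Finset.sum_range_succ' (fun j => (-1 : ℝ) ^ j * (m.choose j) * ((r + t - j).choose r)) m]
      have hsplit : ∀ j ∈ Finset.range (m + 1),
          (-1 : ℝ) ^ (j + 1) * ((m + 1).choose (j + 1)) * ((r + t - (j + 1)).choose r) =
          (-1 : ℝ) ^ (j + 1) * (m.choose (j + 1)) * ((r + t - (j + 1)).choose r) -
          (-1 : ℝ) ^ j * (m.choose j) * ((r + t - 1 - j).choose r) := by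
        intro j _
        rw [Nat.choose_succ_succ, show r + t - 1 - j = r + t - (j + 1) by omega]
        push_cast
        ring
      rw [Finset.sum_congr rfl hsplit, Finset.sum_sub_distrib,
        Finset.sum_range_succ (fun j => (-1 : ℝ) ^ (j + 1) * (m.choose (j + 1)) *
          ((r + t - (j + 1)).choose r)) m]
      simp
      ring
    rw [hrec, ih r t (by omega)]
    rcases t with _ | t
    · have hz : ∑ j ∈ Finset.range (m + 1),
          (-1 : ℝ) ^ j * (m.choose j) * ((r + 0 - 1 - j).choose r) = 0 := by
        refine Finset.sum_eq_zero fun j _ => ?_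
        rw [Nat.choose_eq_zero_of_lt (show r + 0 - 1 - j < r by omega)]
        simp
      rw [hz]
      simp
    · rw [show r + (t + 1) - 1 = r + t by omega, ih r t (by omega),
        show r + (t + 1) - m = (r + t - m) + 1 by omega,
        show r + (t + 1) - (m + 1) = r + t - m by omega, Nat.choose_succ_succ]
      push_cast
      ring

/-- Coefficient of the signed measure annihilating polynomials of degree at most `k`. -/
def annihCoeff (n k : ℕ) (q : ℝ) : ℝ :=
  ((n.choose (k + 1) : ℝ) / ((n - k + 1).choose 2 : ℝ)) * q ^ (k - 1) *
    (1 - ((n - k + 1 : ℕ) : ℝ) * q)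

/-- Mass of each point with `j` zeros under the signed `k`-wise independent exchangeable measure
supported on points with at most `k` zeros. -/
def baseWeight (n k : ℕ) (q : ℝ) (j : ℕ) : ℝ :=
  ∑ t ∈ Finset.range (k + 1), (-1 : ℝ) ^ (t + j) * ((n - j).choose (n - t)) * q ^ t

/-- Mass of each point with `j` zeros under the extremal exchangeable measure. -/
def extremalWeight (n k : ℕ) (q : ℝ) (j : ℕ) : ℝ :=
  baseWeight n k q j + annihCoeff n k q * ((-1 : ℝ) ^ j * ((k + 1).choose j) / (n.choose j))

lemma sum_choose_mul_baseWeight {n k s : ℕ} (hs : s ≤ k) (hkn : k ≤ n) (q : ℝ) :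
    ∑ j ∈ Finset.range (n - s + 1), ((n - s).choose j : ℝ) * baseWeight n k q j = (1 - q) ^ s := by
  simp only [baseWeight, Finset.mul_sum]
  rw [Finset.sum_comm]
  have h1 : ∀ t ∈ Finset.range (k + 1), ∑ j ∈ Finset.range (n - s + 1),
      ((n - s).choose j : ℝ) * ((-1 : ℝ) ^ (t + j) * ((n - j).choose (n - t)) * q ^ t) =
      (-q) ^ t * (s.choose t) := by
    intro t ht
    have ht' := Finset.mem_range.1 ht
    have key := sum_alternating_choose_mul_choose (n - s) (n - t) t (by omega)
    rw [show n - t + t = n by omega, show n - (n - s) = s by omega] at key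
    rw [← key, Finset.mul_sum]
    refine Finset.sum_congr rfl fun j _ => ?_
    rw [pow_add, neg_pow q]
    ring
  rw [Finset.sum_congr rfl h1, sub_eq_neg_add, add_pow]
  refine (Finset.sum_subset (Finset.range_mono (show s + 1 ≤ k + 1 by omega))
    fun t _ ht => ?_).symm.trans ?_
  · rw [Finset.mem_range, not_lt] at ht
    rw [Nat.choose_eq_zero_of_lt (show s < t by omega)]
    simp
  · exact Finset.sum_congr rfl fun t _ => by simp

lemma sum_choose_mul_annih {n k s : ℕ} (hs : s ≤ k) (hkn : k + 1 ≤ n) :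
    ∑ j ∈ Finset.range (n - s + 1),
      ((n - s).choose j : ℝ) * ((-1 : ℝ) ^ j * ((k + 1).choose j) / (n.choose j)) = 0 := by
  have key := sum_alternating_choose_mul_choose (k + 1) s (n - s) (by omega)
  rw [show s + (n - s) = n by omega,
    Nat.choose_eq_zero_of_lt (show n - (k + 1) < n - s by omega)] at key
  have hterm : ∀ j ≤ n, ((n - s).choose j : ℝ) * ((-1 : ℝ) ^ j * ((k + 1).choose j) / (n.choose j))
      = (n.choose s : ℝ)⁻¹ * ((-1 : ℝ) ^ j * ((k + 1).choose j) * ((n - j).choose s)) := by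
    intro j hj
    have h1 : (n.choose j : ℝ) ≠ 0 := by exact_mod_cast (Nat.choose_pos hj).ne'
    have h2 : (n.choose s : ℝ) ≠ 0 := by exact_mod_cast (Nat.choose_pos (by omega : s ≤ n)).ne'
    have h3 : (n.choose s : ℝ) * ((n - s).choose j) = n.choose j * ((n - j).choose s) := by
      have a := Nat.choose_mul (n := n) (k := s + j) (s := s) (by omega)
      have b := Nat.choose_mul (n := n) (k := s + j) (s := j) (by omega)
      rw [show s + j - s = j by omega] at a
      rw [show s + j - j = s by omega, ← Nat.choose_symm_add, a] at b
      exact_mod_cast b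
    field_simp
    linear_combination ((k + 1).choose j : ℝ) * h3
  have hext : ∑ j ∈ Finset.range (n + 1),
      ((n - s).choose j : ℝ) * ((-1 : ℝ) ^ j * ((k + 1).choose j) / (n.choose j)) = 0 := by
    rw [Finset.sum_congr rfl fun j hj => hterm j (by have := Finset.mem_range.1 hj; omega),
      ← Finset.mul_sum]
    refine mul_eq_zero_of_right _ ((Finset.sum_subset (Finset.range_mono (by omega))
      fun j _ hj => ?_).symm.trans (key.trans (by simp)))
    rw [Finset.mem_range, not_lt] at hj
    rw [Nat.choose_eq_zero_of_lt (show k + 1 < j by omega)]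
    simp
  rw [← hext]
  refine Finset.sum_subset (Finset.range_mono (by omega)) fun j _ hj => ?_
  rw [Finset.mem_range, not_lt] at hj
  rw [Nat.choose_eq_zero_of_lt (show n - s < j by omega)]
  simp

lemma sum_choose_mul_extremalWeight {n k s : ℕ} (hs : s ≤ k) (hkn : k + 1 ≤ n) (q : ℝ) :
    ∑ j ∈ Finset.range (n - s + 1), ((n - s).choose j : ℝ) * extremalWeight n k q j =
      (1 - q) ^ s := by
  have h2 := sum_choose_mul_annih hs hkn
  simp only [extremalWeight, mul_add, Finset.sum_add_distrib]
  rw [sum_choose_mul_baseWeight hs (by omega)]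
  simp only [mul_left_comm _ (annihCoeff n k q), ← Finset.mul_sum, h2]
  simp

/-- The set of coordinates of `x` equal to `0`. -/
def zeroSet {n : ℕ} (x : Fin n → Bool) : Finset (Fin n) :=
  Finset.univ.filter fun i => x i = false

lemma prAll_comp_card_zeroSet {n : ℕ} (w : ℕ → ℝ) (S : Finset (Fin n)) :
    prAll (fun x => w (zeroSet x).card) S =
      ∑ j ∈ Finset.range (n - S.card + 1), ((n - S.card).choose j : ℝ) * w j := by
  have h := Finset.sum_powerset_apply_card w (x := Sᶜ)
  rw [Finset.card_compl, Fintype.card_fin] at h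
  simp only [← nsmul_eq_mul]
  rw [← h, prAll]
  refine Finset.sum_nbij' zeroSet (fun Z i => decide (i ∉ Z)) ?_ ?_ ?_ ?_ ?_
  · intro x hx
    simp only [Finset.mem_filter, Finset.mem_univ, true_and] at hx
    rw [Finset.mem_powerset]
    intro i hi
    rw [Finset.mem_compl]
    intro hS
    simp [zeroSet, hx i hS] at hi
  · intro Z hZ
    rw [Finset.mem_powerset] at hZ
    simp only [Finset.mem_filter, Finset.mem_univ, true_and, decide_eq_true_eq]
    intro i hi hiZ
    exact Finset.mem_compl.1 (hZ hiZ) hi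
  · intro x _
    funext i
    cases h : x i <;> simp [zeroSet, h]
  · intro Z _
    ext i
    simp [zeroSet]
  · intro x _
    rfl

lemma prAll_empty {n : ℕ} (f : (Fin n → Bool) → ℝ) : prAll f ∅ = ∑ x, f x := by
  simp [prAll]

lemma memA_extremal {n k : ℕ} (hkn : k + 1 ≤ n) (q : ℝ)
    (hw : ∀ j ≤ n, 0 ≤ extremalWeight n k q j) :
    memA n k (1 - q) fun x => extremalWeight n k q (zeroSet x).card := by
  refine ⟨fun x => hw _ ((Finset.card_le_univ _).trans (by simp)), ?_, fun S _ hS => ?_⟩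
  · rw [← prAll_empty (fun x => extremalWeight n k q (zeroSet x).card), prAll_comp_card_zeroSet,
      Finset.card_empty, sum_choose_mul_extremalWeight (Nat.zero_le _) hkn, pow_zero]
  · rw [prAll_comp_card_zeroSet, sum_choose_mul_extremalWeight hS hkn]

lemma prAll_eq_pow {n k : ℕ} {p : ℝ} {f : (Fin n → Bool) → ℝ} (hf : memA n k p f)
    (S : Finset (Fin n)) (hS : S.card ≤ k) : prAll f S = p ^ S.card := by
  rcases S.eq_empty_or_nonempty with rfl | hne
  · simpa [prAll_empty] using hf.2.1
  · exact hf.2.2 S hne.card_pos hS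

/-- Moments of the number of ones, in terms of the probabilities `prAll f S`. -/
lemma sum_mul_pow_card_zeroSet {n : ℕ} (f : (Fin n → Bool) → ℝ) (s : ℕ) :
    ∑ x, f x * ((n : ℝ) - (zeroSet x).card) ^ s =
      ∑ t : Fin s → Fin n, prAll f (Finset.univ.image t) := by
  have hcard : ∀ x : Fin n → Bool,
      (n : ℝ) - (zeroSet x).card = ∑ i : Fin n, if x i = true then (1 : ℝ) else 0 := by
    intro x
    have h := Finset.card_filter_add_card_filter_not (s := (Finset.univ : Finset (Fin n)))
      (fun i => x i = true)
    rw [Finset.card_univ, Fintype.card_fin] at h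
    have h' : (zeroSet x).card = (Finset.univ.filter fun i => ¬ x i = true).card := by
      simp [zeroSet]
    rw [Finset.sum_boole, h']
    rw [sub_eq_iff_eq_add]
    exact_mod_cast h.symm
  simp only [hcard, Fintype.sum_pow, Finset.mul_sum]
  rw [Finset.sum_comm]
  refine Finset.sum_congr rfl fun t _ => ?_
  rw [prAll, Finset.sum_filter]
  refine Finset.sum_congr rfl fun x _ => ?_
  rw [Finset.prod_ite_zero]
  simp

/-- Expectations of polynomials of degree at most `k` in the number of ones agree on `A(n,k,p)`. -/
lemma sum_mul_eval_eq {n k : ℕ} {p : ℝ} {f g : (Fin n → Bool) → ℝ} (hf : memA n k p f)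
    (hg : memA n k p g) (P : Polynomial ℝ) (hP : P.natDegree ≤ k) :
    ∑ x, f x * P.eval ((n : ℝ) - (zeroSet x).card) =
      ∑ x, g x * P.eval ((n : ℝ) - (zeroSet x).card) := by
  simp only [Polynomial.eval_eq_sum_range, Finset.mul_sum]
  rw [Finset.sum_comm, Finset.sum_comm (s := (Finset.univ : Finset (Fin n → Bool)))]
  refine Finset.sum_congr rfl fun s hs => ?_
  have hs' := Finset.mem_range.1 hs
  simp only [mul_left_comm _ (P.coeff s), ← Finset.mul_sum]
  rw [sum_mul_pow_card_zeroSet, sum_mul_pow_card_zeroSet]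
  congr 1
  refine Finset.sum_congr rfl fun t _ => ?_
  have hcard : (Finset.univ.image t).card ≤ k :=
    Finset.card_image_le.trans (by simp; omega)
  rw [prAll_eq_pow hf _ hcard, prAll_eq_pow hg _ hcard]

/-- The polynomial in the number of ones whose roots correspond to
`1, …, l, l + 2, l + 3` zeros. -/
def dualPoly (n l : ℕ) : Polynomial ℝ :=
  (∏ i ∈ Finset.range l, (Polynomial.X - Polynomial.C ((n : ℝ) - (i + 1)))) *
    ((Polynomial.X - Polynomial.C ((n : ℝ) - (l + 2))) *
      (Polynomial.X - Polynomial.C ((n : ℝ) - (l + 3))))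

lemma natDegree_dualPoly_le (n l : ℕ) : (dualPoly n l).natDegree ≤ l + 2 := by
  refine Polynomial.natDegree_mul_le.trans (add_le_add ?_ ?_)
  · refine (Polynomial.natDegree_prod_le _ _).trans ?_
    simp only [Polynomial.natDegree_X_sub_C]
    simp
  · refine Polynomial.natDegree_mul_le.trans ?_
    simp only [Polynomial.natDegree_X_sub_C]
    norm_num

lemma eval_dualPoly (n l : ℕ) (y : ℝ) : (dualPoly n l).eval ((n : ℝ) - y) =
    (∏ i ∈ Finset.range l, ((i : ℝ) + 1 - y)) * (((l : ℝ) + 2 - y) * ((l : ℝ) + 3 - y)) := by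
  simp only [dualPoly, Polynomial.eval_mul, Polynomial.eval_prod, Polynomial.eval_sub,
    Polynomial.eval_X, Polynomial.eval_C]
  congr 1
  · exact Finset.prod_congr rfl fun i _ => by ring
  · ring

lemma eval_dualPoly_nonneg (n l : ℕ) (hl : Even l) (y : ℕ) :
    0 ≤ (dualPoly n l).eval ((n : ℝ) - y) := by
  rw [eval_dualPoly]
  refine mul_nonneg ?_ ?_
  · rcases Nat.eq_zero_or_pos y with rfl | hy
    · exact Finset.prod_nonneg fun i _ => by rw [Nat.cast_zero, sub_zero]; positivity
    · by_cases hyl : y ≤ l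
      · refine (Finset.prod_eq_zero (i := y - 1) (Finset.mem_range.2 (by omega)) ?_).ge
        rw [Nat.cast_sub hy]
        simp
      · rw [← Finset.prod_congr rfl fun (i : ℕ) (_ : i ∈ Finset.range l) =>
          (neg_sub ((y : ℝ)) ((i : ℝ) + 1)), Finset.prod_neg, Finset.card_range, hl.neg_one_pow,
          one_mul]
        refine Finset.prod_nonneg fun i hi => ?_
        have : i + 1 ≤ y := by have := Finset.mem_range.1 hi; omega
        have : (i : ℝ) + 1 ≤ y := by exact_mod_cast this
        linarith
  · rcases le_or_gt y (l + 2) with h | h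
    · have : (y : ℝ) ≤ l + 2 := by exact_mod_cast h
      exact mul_nonneg (by linarith) (by linarith)
    · have h' : l + 3 ≤ y := h
      have : (l : ℝ) + 3 ≤ y := by exact_mod_cast h'
      exact mul_nonneg_of_nonpos_of_nonpos (by linarith) (by linarith)

lemma eval_dualPoly_zero_pos (n l : ℕ) : 0 < (dualPoly n l).eval ((n : ℝ) - (0 : ℕ)) := by
  rw [eval_dualPoly]
  refine mul_pos (Finset.prod_pos fun i _ => ?_) ?_
  · rw [Nat.cast_zero, sub_zero]
    positivity
  · rw [Nat.cast_zero, sub_zero, sub_zero]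
    positivity

lemma eval_dualPoly_eq_zero (n l y : ℕ) (hy : y ≠ 0) (hy1 : y ≠ l + 1) (hy2 : y ≤ l + 3) :
    (dualPoly n l).eval ((n : ℝ) - y) = 0 := by
  rw [eval_dualPoly]
  by_cases hyl : y ≤ l
  · refine mul_eq_zero_of_left
      (Finset.prod_eq_zero (i := y - 1) (Finset.mem_range.2 (by omega)) ?_) _
    rw [Nat.cast_sub (by omega)]
    simp
  · have h : y = l + 2 ∨ y = l + 3 := by omega
    rcases h with rfl | rfl <;> simp

lemma prAll_univ {n : ℕ} (f : (Fin n → Bool) → ℝ) :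
    prAll f Finset.univ = f fun _ => true := by
  rw [prAll, Finset.sum_eq_single_of_mem (fun _ => true) (by simp)]
  intro x hx hne
  exact absurd (funext fun i => by simpa using (Finset.mem_filter.1 hx).2 i (Finset.mem_univ i)) hne

lemma card_zeroSet_eq_zero {n : ℕ} (x : Fin n → Bool) :
    (zeroSet x).card = 0 ↔ x = fun _ => true := by
  rw [Finset.card_eq_zero, zeroSet, Finset.filter_eq_empty_iff]
  constructor
  · intro h
    funext i
    simpa using h (Finset.mem_univ i)
  · rintro rfl
    simp

/-- Complementary slackness: a feasible measure supported on the zeros of the dual polynomial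
(and on the all-ones point) is optimal. -/
lemma prAll_univ_le_of_slack {n l : ℕ} {p : ℝ} (hl : Even l) {f g : (Fin n → Bool) → ℝ}
    (hf : memA n (l + 2) p f) (hg : memA n (l + 2) p g)
    (hslack : ∀ x, (zeroSet x).card = l + 1 ∨ l + 3 < (zeroSet x).card → g x = 0) :
    prAll f Finset.univ ≤ prAll g Finset.univ := by
  have hE := sum_mul_eval_eq hf hg (dualPoly n l) (natDegree_dualPoly_le n l)
  have h0 : (zeroSet (fun _ : Fin n => true)).card = 0 := (card_zeroSet_eq_zero _).2 rfl
  have hgE : ∑ x, g x * (dualPoly n l).eval ((n : ℝ) - (zeroSet x).card) =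
      (g fun _ => true) * (dualPoly n l).eval ((n : ℝ) - (0 : ℕ)) := by
    rw [Finset.sum_eq_single_of_mem (fun _ => true) (Finset.mem_univ _), h0]
    intro x _ hx
    by_cases h : (zeroSet x).card = l + 1 ∨ l + 3 < (zeroSet x).card
    · rw [hslack x h, zero_mul]
    · push Not at h
      rw [eval_dualPoly_eq_zero n l _ (fun h' => hx ((card_zeroSet_eq_zero x).1 h'))
        h.1 h.2, mul_zero]
  have hfE : (f fun _ => true) * (dualPoly n l).eval ((n : ℝ) - (0 : ℕ)) ≤
      ∑ x, f x * (dualPoly n l).eval ((n : ℝ) - (zeroSet x).card) := by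
    have h := Finset.single_le_sum
      (f := fun x => f x * (dualPoly n l).eval ((n : ℝ) - (zeroSet x).card))
      (fun x _ => mul_nonneg (hf.1 x) (eval_dualPoly_nonneg n l hl _))
      (Finset.mem_univ (fun _ => true))
    simpa only [h0] using h
  rw [prAll_univ, prAll_univ]
  exact le_of_mul_le_mul_right (hfE.trans (hE.trans hgE).le) (eval_dualPoly_zero_pos n l)

lemma baseWeight_eq (n j m : ℕ) (h : j + m ≤ n) (q : ℝ) :
    baseWeight n (j + m) q j =
      q ^ j * ∑ i ∈ Finset.range (m + 1), (-1 : ℝ) ^ i * ((n - j).choose i) * q ^ i := by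
  rw [baseWeight, add_assoc, Finset.sum_range_add]
  have hz : ∑ t ∈ Finset.range j, (-1 : ℝ) ^ (t + j) * ((n - j).choose (n - t)) * q ^ t = 0 := by
    refine Finset.sum_eq_zero fun t ht => ?_
    have := Finset.mem_range.1 ht
    rw [Nat.choose_eq_zero_of_lt (show n - j < n - t by omega)]
    simp
  rw [hz, zero_add, Finset.mul_sum]
  refine Finset.sum_congr rfl fun i hi => ?_
  have := Finset.mem_range.1 hi
  rw [← Nat.choose_symm (show i ≤ n - j by omega), show n - j - i = n - (j + i) by omega,
    show j + i + j = i + 2 * j by ring, pow_add, pow_mul, pow_add]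
  simp
  ring

lemma sum_alternating_choose_succ (r l : ℕ) (x : ℝ) :
    ∑ i ∈ Finset.range (l + 1 + 1), (-1 : ℝ) ^ i * ((l + 1 + r).choose i) * x ^ i =
      (1 - x) * ∑ i ∈ Finset.range (l + 1), (-1 : ℝ) ^ i * ((l + r).choose i) * x ^ i +
        (-1) ^ (l + 1) * ((l + r).choose (l + 1)) * x ^ (l + 1) := by
  rw [Finset.sum_range_succ']
  have hsplit : ∀ i ∈ Finset.range (l + 1),
      (-1 : ℝ) ^ (i + 1) * ((l + 1 + r).choose (i + 1)) * x ^ (i + 1) =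
      (-1 : ℝ) ^ (i + 1) * ((l + r).choose (i + 1)) * x ^ (i + 1) -
        x * ((-1 : ℝ) ^ i * ((l + r).choose i) * x ^ i) := by
    intro i _
    rw [show l + 1 + r = l + r + 1 by omega, Nat.choose_succ_succ]
    push_cast
    ring
  rw [Finset.sum_congr rfl hsplit, Finset.sum_sub_distrib, ← Finset.mul_sum,
    Finset.sum_range_succ (fun i => (-1 : ℝ) ^ (i + 1) * ((l + r).choose (i + 1)) * x ^ (i + 1))]
  rw [Finset.sum_range_succ' (fun i => (-1 : ℝ) ^ i * ((l + r).choose i) * x ^ i)]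
  simp
  ring

lemma choose_add_succ_lt {r l : ℕ} (hr : 2 ≤ r) (hl : 1 ≤ l) :
    ((l + r).choose (l + 1) : ℝ) < r * ((l - 1 + r).choose l) := by
  obtain ⟨l, rfl⟩ : ∃ m, l = m + 1 := ⟨l - 1, by omega⟩
  obtain ⟨r, rfl⟩ : ∃ m, r = m + 1 := ⟨r - 1, by omega⟩
  have h := Nat.add_one_mul_choose_eq (l + (r + 1)) (l + 1)
  rw [show l + (r + 1) + 1 = l + 1 + (r + 1) by omega] at h
  rw [show l + 1 - 1 + (r + 1) = l + (r + 1) by omega]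
  have hc : 0 < (l + (r + 1)).choose (l + 1) := Nat.choose_pos (by omega)
  set a := (l + (r + 1)).choose (l + 1)
  set b := (l + 1 + (r + 1)).choose (l + 1 + 1)
  have : b < (r + 1) * a := by
    nlinarith [mul_pos hc (show 0 < r by omega), Nat.zero_le (l * r * a)]
  exact_mod_cast this

/-- Truncated alternating binomial sums are positive at `1 / (r + 1)`. -/
lemma alternating_sum_pos {r : ℕ} (hr : 2 ≤ r) {l : ℕ} (hl : l ≠ 1) :
    0 < ∑ i ∈ Finset.range (l + 1),
      (-1 : ℝ) ^ i * ((l + r).choose i) * (1 / ((r : ℝ) + 1)) ^ i := by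
  set x : ℝ := 1 / ((r : ℝ) + 1) with hx
  set B : ℕ → ℝ := fun l => ∑ i ∈ Finset.range (l + 1),
      (-1 : ℝ) ^ i * ((l + r).choose i) * x ^ i with hB
  have hr0 : (0 : ℝ) < r := by exact_mod_cast (by omega : 0 < r)
  have hx0 : 0 < x := by positivity
  have h1x : 1 - x = r * x := by
    rw [hx]
    field_simp
    ring
  have hrec : ∀ l, B (l + 1) = r * x * B l +
      (-1) ^ (l + 1) * ((l + r).choose (l + 1)) * x ^ (l + 1) := by
    intro l
    rw [← h1x]
    exact sum_alternating_choose_succ r l x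
  have hrx : 0 < r * x := by positivity
  have heven : ∀ m, 0 ≤ B (2 * m + 1) → 0 < B (2 * m + 2) := by
    intro m hm
    rw [hrec (2 * m + 1), Even.neg_one_pow ⟨m + 1, by ring⟩]
    have : (0 : ℝ) < ((2 * m + 1 + r).choose (2 * m + 1 + 1)) := by
      exact_mod_cast Nat.choose_pos (by omega)
    positivity
  have hodd : ∀ m, 0 ≤ B (2 * m + 1) → 0 < B (2 * m + 3) := by
    intro m hm
    rw [hrec (2 * m + 2), hrec (2 * m + 1), Even.neg_one_pow (n := 2 * m + 1 + 1) ⟨m + 1, by ring⟩,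
      Odd.neg_one_pow (n := 2 * m + 2 + 1) ⟨m + 1, by ring⟩]
    have h := choose_add_succ_lt (r := r) (l := 2 * m + 2) hr (by omega)
    rw [show 2 * m + 2 - 1 = 2 * m + 1 by omega] at h
    have hp : 0 < x ^ (2 * m + 3) := by positivity
    have h1 := mul_lt_mul_of_pos_right h hp
    have h2 : 0 ≤ r * x * (r * x * B (2 * m + 1)) := by positivity
    rw [show 2 * m + 1 + 1 = 2 * m + 2 by ring, show 2 * m + 2 + 1 = 2 * m + 3 by ring] at *
    have h3 : x ^ (2 * m + 3) = x * x ^ (2 * m + 2) := by ring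
    rw [h3] at h1 ⊢
    nlinarith
  have hodd0 : ∀ m, 0 ≤ B (2 * m + 1) := by
    intro m
    induction m with
    | zero =>
      rw [hrec 0]
      simp [hB]
    | succ m ih => exact (hodd m ih).le
  change 0 < B l
  rcases l with _ | _ | l
  · simp [hB]
  · exact absurd rfl hl
  · rcases Nat.even_or_odd' l with ⟨m, rfl | rfl⟩
    · exact heven m (hodd0 m)
    · exact hodd m (hodd0 m)

lemma extremalWeight_eq_zero_of_lt {n k j : ℕ} (hj : k + 1 < j) (hjn : j ≤ n)
    (q : ℝ) : extremalWeight n k q j = 0 := by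
  rw [extremalWeight, Nat.choose_eq_zero_of_lt hj, baseWeight, Finset.sum_eq_zero]
  · simp
  · intro t ht
    have := Finset.mem_range.1 ht
    rw [Nat.choose_eq_zero_of_lt (show n - j < n - t by omega)]
    simp

lemma extremalWeight_succ {n k : ℕ} (hk : Even k) (hkn : k + 1 ≤ n) (q : ℝ) :
    extremalWeight n k q (k + 1) = -annihCoeff n k q / (n.choose (k + 1)) := by
  rw [extremalWeight, baseWeight, Finset.sum_eq_zero, hk.add_one.neg_one_pow, Nat.choose_self]
  · simp
    ring
  · intro t ht
    have := Finset.mem_range.1 ht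
    rw [Nat.choose_eq_zero_of_lt (show n - (k + 1) < n - t by omega)]
    simp

lemma extremalWeight_pred {n l : ℕ} (hl : Even l) (hn : l + 3 ≤ n) (q : ℝ) :
    extremalWeight n (l + 2) q (l + 1) = 0 := by
  rw [extremalWeight, baseWeight_eq n (l + 1) 1 (by omega), hl.add_one.neg_one_pow, annihCoeff]
  have h := Nat.choose_mul (n := n) (k := l + 3) (s := l + 1) (by omega)
  rw [show l + 3 - (l + 1) = 2 by omega, show n - (l + 1) = n - (l + 2) + 1 by omega] at h
  have h' : (n.choose (l + 3) : ℝ) * ((l + 3).choose (l + 1)) =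
      n.choose (l + 1) * ((n - (l + 2) + 1).choose 2) := by exact_mod_cast h
  rw [show n - (l + 1) = n - (l + 2) + 1 by omega, show l + 2 + 1 = l + 3 by omega,
    show l + 2 - 1 = l + 1 by omega]
  have h1 : (n.choose (l + 1) : ℝ) ≠ 0 := by exact_mod_cast (Nat.choose_pos (by omega)).ne'
  have h2 : ((n - (l + 2) + 1).choose 2 : ℝ) ≠ 0 := by
    exact_mod_cast (Nat.choose_pos (by omega)).ne'
  generalize n - (l + 2) + 1 = N at *
  simp only [Finset.sum_range_succ, Finset.sum_range_zero, Nat.choose_zero_right,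
    Nat.choose_one_right]
  field_simp
  push_cast
  linear_combination -q ^ (l + 1) * (1 - N * q) * h'

lemma extremalWeight_zero (n k : ℕ) (hkn : k ≤ n) (q : ℝ) :
    extremalWeight n k q 0 = bonf n k q +
      ((n.choose (k + 1) : ℝ) / ((n - k + 1).choose 2 : ℝ)) * q ^ (k - 1) *
        bonf (n - k + 1) 1 q := by
  have h := baseWeight_eq n 0 k (by omega) q
  rw [Nat.zero_add] at h
  have hlin : bonf (n - k + 1) 1 q = 1 - ((n - k + 1 : ℕ) : ℝ) * q := by
    simp [bonf, Finset.sum_range_succ]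
    ring
  rw [hlin, extremalWeight, h, annihCoeff, bonf, if_neg (by omega)]
  simp

lemma continuous_extremalWeight (n k j : ℕ) : Continuous fun q => extremalWeight n k q j := by
  unfold extremalWeight baseWeight annihCoeff
  fun_prop

lemma extremalWeight_pos {n k j : ℕ} (hkn : k + 2 ≤ n) (hj : j ≤ k) (hjk : j + 1 ≠ k) :
    0 < extremalWeight n k (1 / ((n : ℝ) - k + 1)) j := by
  obtain ⟨m, rfl⟩ := Nat.exists_eq_add_of_le hj
  obtain ⟨r, rfl⟩ := Nat.exists_eq_add_of_le (show j + m ≤ n by omega)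
  have hq : ((j + m + r : ℕ) : ℝ) - ((j + m : ℕ) : ℝ) + 1 = (r : ℝ) + 1 := by
    push_cast
    ring
  have hr0 : (r : ℝ) + 1 ≠ 0 := by positivity
  have hc : annihCoeff (j + m + r) (j + m) (1 / ((r : ℝ) + 1)) = 0 := by
    rw [annihCoeff, show j + m + r - (j + m) + 1 = r + 1 by omega]
    push_cast
    field_simp
    simp
  rw [hq, extremalWeight, hc, zero_mul, add_zero, baseWeight_eq _ _ _ (by omega),
    show j + m + r - j = m + r by omega]
  exact mul_pos (by positivity) (alternating_sum_pos (by omega) (by omega))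

/-- `M(n,k,p)` on the second-to-last interval, for even `k`:
there is `p̄₂ < p̄₁ = 1 - 1/(n-k+1)` such that
`M(n,k,p) = B(n,k,1-p) + (C(n,k+1)/C(n-k+1,2)) (1-p)^{k-1} B(n-k+1, 1, 1-p)` on `[p̄₂, p̄₁]`. -/
theorem stmt13 (n k : ℕ) (hk : 2 ≤ k) (hkn : k + 2 ≤ n) (hke : Even k) :
    ∃ p₂ : ℝ, p₂ < 1 - 1 / ((n:ℝ) - (k:ℝ) + 1) ∧
      ∀ p ∈ Set.Icc p₂ (1 - 1 / ((n:ℝ) - (k:ℝ) + 1)),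
        M n k p = bonf n (k : ℤ) (1 - p) +
          ((n.choose (k + 1) : ℝ) / ((n - k + 1).choose 2 : ℝ)) * (1 - p) ^ (k - 1) *
            bonf (n - k + 1) 1 (1 - p) := by
  set p₁ : ℝ := 1 - 1 / ((n:ℝ) - (k:ℝ) + 1) with hp₁
  have hev : ∀ᶠ p in nhds p₁, ∀ j ∈ Finset.range (k + 1), j + 1 ≠ k →
      0 < extremalWeight n k (1 - p) j := by
    rw [Filter.eventually_all_finset]
    intro j hj
    rw [Filter.eventually_imp_distrib_left]
    intro hjk
    have hcont : Continuous fun p : ℝ => extremalWeight n k (1 - p) j :=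
      (continuous_extremalWeight n k j).comp (continuous_const.sub continuous_id)
    refine hcont.continuousAt.eventually (lt_mem_nhds ?_)
    have := extremalWeight_pos hkn (by have := Finset.mem_range.1 hj; omega) hjk
    change 0 < extremalWeight n k (1 - p₁) j
    rwa [hp₁, sub_sub_cancel]
  obtain ⟨ε, hε, hball⟩ := Metric.eventually_nhds_iff.1 hev
  refine ⟨p₁ - ε / 2, by linarith, fun p hp => ?_⟩
  have hpos := hball (y := p) (by
    rw [Real.dist_eq, abs_lt]
    constructor <;> linarith [hp.1, hp.2])
  obtain ⟨l, rfl⟩ : ∃ l, k = l + 2 := ⟨k - 2, by omega⟩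
  have hl : Even l := by
    simpa [Nat.even_add] using hke
  have hnk : (0 : ℝ) < (n : ℝ) - ((l + 2 : ℕ) : ℝ) + 1 := by
    have : ((l + 2 : ℕ) : ℝ) + 2 ≤ n := by exact_mod_cast hkn
    linarith
  have hqlow : 1 / ((n : ℝ) - ((l + 2 : ℕ) : ℝ) + 1) ≤ 1 - p := by
    have := hp.2
    linarith
  have hq0 : 0 ≤ 1 - p := (one_div_pos.2 hnk).le.trans hqlow
  have hcoeff : annihCoeff n (l + 2) (1 - p) ≤ 0 := by
    refine mul_nonpos_of_nonneg_of_nonpos (by positivity) ?_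
    rw [div_le_iff₀ hnk] at hqlow
    rw [Nat.cast_add, Nat.cast_sub (by omega)]
    push_cast at hqlow ⊢
    linarith
  have hw : ∀ j ≤ n, 0 ≤ extremalWeight n (l + 2) (1 - p) j := by
    intro j hj
    rcases lt_trichotomy j (l + 3) with h | rfl | h
    · by_cases hjl : j = l + 1
      · rw [hjl, extremalWeight_pred hl (by omega)]
      · exact (hpos j (Finset.mem_range.2 (by omega)) (by omega)).le
    · rw [extremalWeight_succ hke (by omega)]
      exact div_nonneg (neg_nonneg.2 hcoeff) (Nat.cast_nonneg _)
    · rw [extremalWeight_eq_zero_of_lt (by omega) hj]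
  have hg := memA_extremal (n := n) (k := l + 2) (by omega) (1 - p) hw
  rw [sub_sub_cancel] at hg
  rw [← extremalWeight_zero n (l + 2) (by omega)]
  refine IsGreatest.csSup_eq ⟨⟨_, hg, ?_⟩, ?_⟩
  · rw [prAll_univ, (card_zeroSet_eq_zero _).2 rfl]
  · rintro _ ⟨f, hf, rfl⟩
    have hval : prAll (fun x : Fin n → Bool => extremalWeight n (l + 2) (1 - p) (zeroSet x).card)
        Finset.univ = extremalWeight n (l + 2) (1 - p) 0 := by
      rw [prAll_univ, (card_zeroSet_eq_zero _).2 rfl]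
    rw [← hval]
    refine prAll_univ_le_of_slack hl hf hg fun x hx => ?_
    rcases hx with hx | hx
    · rw [hx, extremalWeight_pred hl (by omega)]
    · exact extremalWeight_eq_zero_of_lt (by omega)
        ((Finset.card_le_univ _).trans (by simp)) _
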